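/- arXiv:1602.01404 — 2 statements merged into one kernel-verified Lean document; each statement's English description precedes it below -/
import Mathlib

section
/- Correctness of the quantum-walk public-key protocol: let U_c be any 2×2 unitary coin, U = S ∘ (I_p ⊗ U_c) one step of the coined quantum walk on the circle with N positions, t ∈ ℕ, l, m : ZMod N, and s ∈ {L, R}. If the public key is |ψ_PK⟩ = U^t(|l⟩⊗|s⟩) and the encrypted message is |ψ(m)⟩ = (T_m ⊗ I_c)|ψ_PK⟩, then (U^t)†|ψ(m)⟩ = |l + m⟩ ⊗ |s⟩, so applying the inverse walk yields exactly the position basis state labeled l + m (mod N) with the original coin state. -/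
/-!
STATEMENT 9: Correctness of the quantum-walk public-key protocol: let U_c be
any 2×2 unitary coin, U = S ∘ (I_p ⊗ U_c) one step of the coined quantum walk
on the circle with N positions, t ∈ ℕ, l, m : ZMod N, and s ∈ {L, R}.  If the
public key is |ψ_PK⟩ = U^t(|l⟩⊗|s⟩) and the encrypted message is
|ψ(m)⟩ = (T_m ⊗ I_c)|ψ_PK⟩, then (U^t)†|ψ(m)⟩ = |l + m⟩ ⊗ |s⟩: applying the
inverse walk yields exactly the position basis state labeled l + m (mod N)
with the original coin state.

The tensor space ℂ^(ZMod N) ⊗ ℂ² is modelled as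
`EuclideanSpace ℂ (ZMod N × Fin 2)` with basis vector |i⟩⊗|s⟩ = `ket N i s`;
coin states |L⟩ = 0, |R⟩ = 1 in Fin 2 (so s ranges over all of Fin 2).
T_m ⊗ I_c is the (unique) operator `TT m` with
(T_m ⊗ I_c)(|i⟩⊗|s⟩) = |i+m⟩⊗|s⟩, the shift S is characterized by its action
on the basis, and I_p ⊗ U_c is the (unique) operator W with
W(|i⟩⊗|s⟩) = |i⟩ ⊗ (U_c|s⟩) = u_{Ls}·|i⟩⊗|L⟩ + u_{Rs}·|i⟩⊗|R⟩.
-/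

/-- The basis vector |i⟩⊗|s⟩ of the walker's Hilbert space ℂ^(ZMod N) ⊗ ℂ². -/
noncomputable def ket (N : ℕ) (i : ZMod N) (s : Fin 2) :
    EuclideanSpace ℂ (ZMod N × Fin 2) :=
  EuclideanSpace.single (i, s) 1

theorem inner_ket (N : ℕ) [NeZero N] (i j : ZMod N) (r s : Fin 2) :
    inner ℂ (ket N i r) (ket N j s) = if i = j ∧ r = s then 1 else 0 := by
  simp [ket, EuclideanSpace.inner_single_left]

/-- Continuous linear maps that agree on all basis kets are equal. -/
theorem clm_ext_ket (N : ℕ) [NeZero N] {F : Type*} [AddCommMonoid F] [Module ℂ F]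
    [TopologicalSpace F] {A B : EuclideanSpace ℂ (ZMod N × Fin 2) →L[ℂ] F}
    (h : ∀ i s, A (ket N i s) = B (ket N i s)) : A = B := by
  apply ContinuousLinearMap.coe_injective
  refine (EuclideanSpace.basisFun (ZMod N × Fin 2) ℂ).toBasis.ext fun p => ?_
  simpa [ket] using h p.1 p.2

/-- An operator that preserves the inner products of the basis kets is an isometry. -/
theorem adjoint_mul_self_of_inner_ket (N : ℕ) [NeZero N]
    (A : EuclideanSpace ℂ (ZMod N × Fin 2) →L[ℂ] EuclideanSpace ℂ (ZMod N × Fin 2))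
    (h : ∀ i j r s, inner ℂ (A (ket N i r)) (A (ket N j s)) = inner ℂ (ket N i r) (ket N j s)) :
    star A * A = 1 := by
  refine clm_ext_ket N fun j s => ?_
  ext p
  have := h p.1 j p.2 s
  rw [← ContinuousLinearMap.adjoint_inner_right] at this
  simpa [ket, ContinuousLinearMap.star_eq_adjoint, EuclideanSpace.inner_single_left] using this

theorem star_pow_mul_pow_self {M : Type*} [Monoid M] [StarMul M] {a : M}
    (h : star a * a = 1) (t : ℕ) : star (a ^ t) * a ^ t = 1 := by
  induction t with
  | zero => simp
  | succ t ih =>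
    rw [pow_succ, star_mul, mul_assoc, ← mul_assoc (star (a ^ t)), ih, one_mul, h]

theorem protocol_correctness (N : ℕ) [NeZero N]
    (Uc : Matrix (Fin 2) (Fin 2) ℂ) (hUc : Uc ∈ Matrix.unitaryGroup (Fin 2) ℂ)
    (S : EuclideanSpace ℂ (ZMod N × Fin 2) →L[ℂ] EuclideanSpace ℂ (ZMod N × Fin 2))
    (hSR : ∀ i : ZMod N, S (ket N i 1) = ket N (i + 1) 1)
    (hSL : ∀ i : ZMod N, S (ket N i 0) = ket N (i - 1) 0)
    (W : EuclideanSpace ℂ (ZMod N × Fin 2) →L[ℂ] EuclideanSpace ℂ (ZMod N × Fin 2))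
    (hW : ∀ (i : ZMod N) (s : Fin 2),
      W (ket N i s) = Uc 0 s • ket N i 0 + Uc 1 s • ket N i 1)
    (TT : ZMod N →
      (EuclideanSpace ℂ (ZMod N × Fin 2) →L[ℂ] EuclideanSpace ℂ (ZMod N × Fin 2)))
    (hTT : ∀ (m i : ZMod N) (s : Fin 2), TT m (ket N i s) = ket N (i + m) s)
    (t : ℕ) (l m : ZMod N) (s : Fin 2)
    (ψPK : EuclideanSpace ℂ (ZMod N × Fin 2)) (hψPK : ψPK = ((S ∘L W) ^ t) (ket N l s))
    (ψm : EuclideanSpace ℂ (ZMod N × Fin 2)) (hψm : ψm = TT m ψPK) :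
    ContinuousLinearMap.adjoint ((S ∘L W) ^ t) ψm = ket N (l + m) s := by
  have hS : star S * S = 1 := by
    refine adjoint_mul_self_of_inner_ket N S fun i j r s => ?_
    fin_cases r <;> fin_cases s <;> simp [hSR, hSL, inner_ket]
  have hWW : star W * W = 1 := by
    refine adjoint_mul_self_of_inner_ket N W fun i j r s => ?_
    have hU := congrFun (congrFun (Matrix.mem_unitaryGroup_iff'.mp hUc) r) s
    simp only [Matrix.mul_apply, Matrix.star_apply, Fin.sum_univ_two, Matrix.one_apply,
      RCLike.star_def] at hU
    simp only [hW, inner_add_left, inner_add_right, inner_smul_left, inner_smul_right, inner_ket]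
    by_cases hij : i = j
    · simp only [hij, true_and, ← hU]
      simp
      ring
    · simp [hij]
  have hU : star (S * W) * (S * W) = 1 := by
    rw [star_mul, mul_assoc, ← mul_assoc (star S), hS, one_mul, hWW]
  have hSket : ∀ i s, TT m (S (ket N i s)) = S (TT m (ket N i s)) := by
    intro i s
    fin_cases s
    · simp [hSL, hTT, sub_add_eq_add_sub]
    · simp [hSR, hTT, add_right_comm]
  have hcomm : Commute (TT m) (S * W) := by
    refine clm_ext_ket N fun i s => ?_
    simp [hW, hTT, hSket]
  have hshift : TT m (((S * W) ^ t) (ket N l s)) = ((S * W) ^ t) (ket N (l + m) s) := by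
    rw [← hTT]
    exact congrArg (fun A => A (ket N l s)) (hcomm.pow_right t).eq
  subst hψm hψPK
  change star ((S * W) ^ t) (TT m (((S * W) ^ t) (ket N l s))) = _
  rw [hshift]
  exact congrArg (fun A => A (ket N (l + m) s)) (star_pow_mul_pow_self hU t)
end

section
/- Re-keying ambiguity (security of the message): let U_c be any 2×2 unitary coin, U = S ∘ (I_p ⊗ U_c), t ∈ ℕ, and m, Δl, l' : ZMod N, s ∈ {L,R}. Then (T_m ⊗ I_c) U^t (T_{Δl} ⊗ I_c)(|l'⟩⊗|s⟩) = (T_{m+Δl} ⊗ I_c) U^t (|l'⟩⊗|s⟩); consequently the ciphertext state that corresponds to message m under the secret key with initial position l = l' + Δl is identical to the ciphertext state that corresponds to message m + Δl under the secret key with initial position l'. -/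
/-- Two continuous linear maps that agree on every basis vector |i⟩⊗|s⟩ are equal. -/
theorem ext_ket {N : ℕ} [NeZero N]
    {A B : EuclideanSpace ℂ (ZMod N × Fin 2) →L[ℂ] EuclideanSpace ℂ (ZMod N × Fin 2)}
    (h : ∀ i s, A (ket N i s) = B (ket N i s)) : A = B := by
  refine ContinuousLinearMap.coe_injective
    ((EuclideanSpace.basisFun (ZMod N × Fin 2) ℂ).toBasis.ext fun ⟨i, s⟩ => ?_)
  simpa [ket] using h i s

theorem rekeying_ambiguity (N : ℕ) [NeZero N]
    (Uc : Matrix (Fin 2) (Fin 2) ℂ) (hUc : Uc ∈ Matrix.unitaryGroup (Fin 2) ℂ)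
    (S : EuclideanSpace ℂ (ZMod N × Fin 2) →L[ℂ] EuclideanSpace ℂ (ZMod N × Fin 2))
    (hSR : ∀ i : ZMod N, S (ket N i 1) = ket N (i + 1) 1)
    (hSL : ∀ i : ZMod N, S (ket N i 0) = ket N (i - 1) 0)
    (W : EuclideanSpace ℂ (ZMod N × Fin 2) →L[ℂ] EuclideanSpace ℂ (ZMod N × Fin 2))
    (hW : ∀ (i : ZMod N) (s : Fin 2),
      W (ket N i s) = Uc 0 s • ket N i 0 + Uc 1 s • ket N i 1)
    (TT : ZMod N →
      (EuclideanSpace ℂ (ZMod N × Fin 2) →L[ℂ] EuclideanSpace ℂ (ZMod N × Fin 2)))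
    (hTT : ∀ (m i : ZMod N) (s : Fin 2), TT m (ket N i s) = ket N (i + m) s)
    (t : ℕ) (m Δl l' : ZMod N) (s : Fin 2) :
    TT m (((S ∘L W) ^ t) (TT Δl (ket N l' s))) =
      TT (m + Δl) (((S ∘L W) ^ t) (ket N l' s)) := by
  have hcomm : ∀ k, Commute (TT k) (S ∘L W) := fun k => by
    refine ext_ket fun i r => ?_
    simp only [mul_apply_eq_comp, ContinuousLinearMap.comp_apply, hW, hTT, map_add,
      map_smul, hSL, hSR, sub_add_eq_add_sub, add_right_comm]
  have hpow : ∀ k v, TT k (((S ∘L W) ^ t) v) = ((S ∘L W) ^ t) (TT k v) := fun k v =>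
    DFunLike.congr_fun ((hcomm k).pow_right t).eq v
  rw [hpow, hpow, hTT, hTT, hTT, add_assoc, add_comm Δl m]
end
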